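/- arXiv:2209.06362 — 2 statements merged into one kernel-verified Lean document; each statement's English description precedes it below -/
import Mathlib

section
/- Let a, c, d > 0 with a > d, f = a − d, and r = sqrt(4a²f² − 4af³ + c⁴ + f⁴). Consider the 8×8 symmetric circulant-like matrix M with diagonal entries c² + f², entries −af between vertices 2i and 2i+1 (mod 8), entries −c² between 2i+1 and 2i+2 (mod 8 pattern as in the paper), entries af − f² between 2i and 2i+5 pattern, and −c² between 0 and 7, as given explicitly in the paper. Then the eigenvalues of M are 0, 2f², 2c², 2c² + 2f², c² + f² + r (multiplicity 2), and c² + f² − r (multiplicity 2). -/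
open Polynomial

/-- The columns are orthogonal vectors adapted to the cyclic symmetry `i ↦ i + 2` of the vertices:
four `±1` vectors, followed by four vectors supported on antipodal pairs. -/
def symmetryBasis : Matrix (Fin 8) (Fin 8) ℝ :=
  !![1, 1, 1, 1, 1, 0, 0, 0;
     1, -1, 1, -1, 0, 0, 1, 0;
     1, 1, -1, -1, 0, 1, 0, 0;
     1, -1, -1, 1, 0, 0, 0, 1;
     1, 1, 1, 1, -1, 0, 0, 0;
     1, -1, 1, -1, 0, 0, -1, 0;
     1, 1, -1, -1, 0, -1, 0, 0;
     1, -1, -1, 1, 0, 0, 0, -1]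

/-- The inverse of `symmetryBasis`. -/
noncomputable def symmetryBasisInv : Matrix (Fin 8) (Fin 8) ℝ :=
  !![1/8, 1/8, 1/8, 1/8, 1/8, 1/8, 1/8, 1/8;
     1/8, -1/8, 1/8, -1/8, 1/8, -1/8, 1/8, -1/8;
     1/8, 1/8, -1/8, -1/8, 1/8, 1/8, -1/8, -1/8;
     1/8, -1/8, -1/8, 1/8, 1/8, -1/8, -1/8, 1/8;
     1/2, 0, 0, 0, -1/2, 0, 0, 0;
     0, 0, 1/2, 0, 0, 0, -1/2, 0;
     0, 1/2, 0, 0, 0, -1/2, 0, 0;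
     0, 0, 0, 1/2, 0, 0, 0, -1/2]

theorem symmetryBasisInv_mul_symmetryBasis : symmetryBasisInv * symmetryBasis = 1 := by
  ext i j
  fin_cases i <;> fin_cases j <;>
    norm_num [symmetryBasis, symmetryBasisInv, Matrix.mul_apply, Fin.sum_univ_succ]

/-- The part of the block-diagonalised Hessian acting on vectors odd under the antipodal map. -/
def antipodalBlock (s p q : ℝ) : Matrix (Fin 4) (Fin 4) ℝ :=
  !![s, 0, p, q;
     0, s, -q, p;
     p, -q, s, 0;
     q, p, 0, s]

theorem charpoly_antipodalBlock {s p q r : ℝ} (h : r ^ 2 = p ^ 2 + q ^ 2) :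
    (antipodalBlock s p q).charpoly = (X - C (s + r)) ^ 2 * (X - C (s - r)) ^ 2 := by
  have hC : (C r : ℝ[X]) ^ 2 = C p ^ 2 + C q ^ 2 := by
    simp only [← C_pow, ← C_add, h]
  have key : (antipodalBlock s p q).charpoly = ((X - C s) ^ 2 - (C p ^ 2 + C q ^ 2)) ^ 2 := by
    simp [Matrix.charpoly, Matrix.charmatrix, antipodalBlock, Matrix.det_succ_row_zero,
      Fin.sum_univ_succ, Fin.succAbove]
    ring
  rw [key, ← hC]
  simp only [C_add, C_sub]
  ring

/-- The eigenvalues of the scaled Hessian `M` of `G_{(a,b,c,d)}` at the equilibrium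
`θ*` are `0`, `2f²`, `2c²`, `2c²+2f²`, `c²+f²+r` (multiplicity 2) and `c²+f²−r`
(multiplicity 2), where `f = a − d` and `r = √(4a²f² − 4af³ + c⁴ + f⁴)`; stated via
the characteristic polynomial. -/
theorem Gp_hessian_eigenvalues (a c d f r : ℝ)
    (ha : 0 < a) (hc : 0 < c) (hd : 0 < d) (had : d < a)
    (hf : f = a - d)
    (hr : r = Real.sqrt (4 * a ^ 2 * f ^ 2 - 4 * a * f ^ 3 + c ^ 4 + f ^ 4))
    (M : Matrix (Fin 8) (Fin 8) ℝ)
    (hM : M = !![c^2+f^2, -(a*f), 0, 0, 0, a*f-f^2, 0, -c^2;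
                 -(a*f), c^2+f^2, -c^2, 0, a*f-f^2, 0, 0, 0;
                 0, -c^2, c^2+f^2, -(a*f), 0, 0, 0, a*f-f^2;
                 0, 0, -(a*f), c^2+f^2, -c^2, 0, a*f-f^2, 0;
                 0, a*f-f^2, 0, -c^2, c^2+f^2, -(a*f), 0, 0;
                 a*f-f^2, 0, 0, 0, -(a*f), c^2+f^2, -c^2, 0;
                 0, 0, 0, a*f-f^2, 0, -c^2, c^2+f^2, -(a*f);
                 -c^2, 0, a*f-f^2, 0, 0, 0, -(a*f), c^2+f^2]) :
    M.charpoly =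
      X * (X - C (2 * f ^ 2)) * (X - C (2 * c ^ 2)) *
        (X - C (2 * c ^ 2 + 2 * f ^ 2)) *
        (X - C (c ^ 2 + f ^ 2 + r)) ^ 2 * (X - C (c ^ 2 + f ^ 2 - r)) ^ 2 := by
  have hs : r ^ 2 = (f ^ 2 - 2 * a * f) ^ 2 + (c ^ 2) ^ 2 := by
    rw [hr, Real.sq_sqrt]
    · ring
    · nlinarith [sq_nonneg (f ^ 2 - 2 * a * f), sq_nonneg (c ^ 2)]
  set E := Matrix.diagonal ![0, 2 * (c ^ 2 + f ^ 2), 2 * c ^ 2, 2 * f ^ 2] with hE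
  set B := antipodalBlock (c ^ 2 + f ^ 2) (f ^ 2 - 2 * a * f) (c ^ 2) with hB
  set D := Matrix.reindex finSumFinEquiv finSumFinEquiv (Matrix.fromBlocks E 0 0 B) with hD
  have hDe : D = !![0, 0, 0, 0, 0, 0, 0, 0;
      0, 2 * (c ^ 2 + f ^ 2), 0, 0, 0, 0, 0, 0;
      0, 0, 2 * c ^ 2, 0, 0, 0, 0, 0;
      0, 0, 0, 2 * f ^ 2, 0, 0, 0, 0;
      0, 0, 0, 0, c ^ 2 + f ^ 2, 0, f ^ 2 - 2 * a * f, c ^ 2;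
      0, 0, 0, 0, 0, c ^ 2 + f ^ 2, -c ^ 2, f ^ 2 - 2 * a * f;
      0, 0, 0, 0, f ^ 2 - 2 * a * f, -c ^ 2, c ^ 2 + f ^ 2, 0;
      0, 0, 0, 0, c ^ 2, f ^ 2 - 2 * a * f, 0, c ^ 2 + f ^ 2] := by
    ext i j
    fin_cases i <;> fin_cases j <;> rfl
  have hMD : M * symmetryBasis = symmetryBasis * D := by
    rw [hM, hDe]
    ext i j
    fin_cases i <;> fin_cases j <;>
      simp [symmetryBasis, Matrix.mul_apply, Fin.sum_univ_succ] <;> ring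
  have hinv : symmetryBasis * symmetryBasisInv = 1 :=
    mul_eq_one_comm.mp symmetryBasisInv_mul_symmetryBasis
  have hM' : M = symmetryBasis * (D * symmetryBasisInv) := by
    rw [← mul_assoc, ← hMD, mul_assoc, hinv, mul_one]
  rw [hM', Matrix.charpoly_mul_comm, mul_assoc, symmetryBasisInv_mul_symmetryBasis, mul_one, hD,
    Matrix.charpoly_reindex, Matrix.charpoly_fromBlocks_zero₁₂, hB, charpoly_antipodalBlock hs, hE,
    Matrix.charpoly_diagonal]
  simp only [Fin.prod_univ_four, Matrix.cons_val, C_0, sub_zero, mul_add]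
  ring
end

section
/- Let a, c, d > 0, a > d, c² > 2ad, f = a − d. Then the 8×8 matrix M (the scaled Hessian of G_{(a,b,c,d)} at the equilibrium θ*) is positive semidefinite, its kernel is exactly the span of the all-ones vector (1,...,1), and all other eigenvalues are positive. -/
/-- The scaled Hessian of `G_{(a,b,c,d)}` at `θ*`, with `f = a - d`. -/
def scaledHessian (a c f : ℝ) : Matrix (Fin 8) (Fin 8) ℝ :=
  !![c^2+f^2, -(a*f), 0, 0, 0, a*f-f^2, 0, -c^2;
     -(a*f), c^2+f^2, -c^2, 0, a*f-f^2, 0, 0, 0;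
     0, -c^2, c^2+f^2, -(a*f), 0, 0, 0, a*f-f^2;
     0, 0, -(a*f), c^2+f^2, -c^2, 0, a*f-f^2, 0;
     0, a*f-f^2, 0, -c^2, c^2+f^2, -(a*f), 0, 0;
     a*f-f^2, 0, 0, 0, -(a*f), c^2+f^2, -c^2, 0;
     0, 0, 0, a*f-f^2, 0, -c^2, c^2+f^2, -(a*f);
     -c^2, 0, a*f-f^2, 0, 0, 0, -(a*f), c^2+f^2]

namespace scaledHessian

/-- Sum-of-squares form of the Hessian, from block-diagonalizing it along the shift `i ↦ i + 2`. -/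
theorem four_mul_dotProduct_mulVec (a c f : ℝ) (x : Fin 8 → ℝ) :
    4 * (c ^ 2 + f ^ 2) * (x ⬝ᵥ (scaledHessian a c f).mulVec x) =
      ((c ^ 2 + f ^ 2) * (x 0 + x 2 + x 4 + x 6 - (x 1 + x 3 + x 5 + x 7))) ^ 2 +
      (c ^ 2 + f ^ 2) * (f * (x 0 - x 2 + x 4 - x 6 - (x 1 - x 3 + x 5 - x 7))) ^ 2 +
      (c ^ 2 + f ^ 2) * (c * (x 0 - x 2 + x 4 - x 6 + (x 1 - x 3 + x 5 - x 7))) ^ 2 +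
      2 * ((c ^ 2 + f ^ 2) * (x 0 - x 4) - (2 * a * f - f ^ 2) * (x 1 - x 5)
        + c ^ 2 * (x 3 - x 7)) ^ 2 +
      2 * ((c ^ 2 + f ^ 2) * (x 2 - x 6) - (2 * a * f - f ^ 2) * (x 3 - x 7)
        - c ^ 2 * (x 1 - x 5)) ^ 2 +
      4 * f ^ 2 * (c ^ 2 - 2 * a * (a - f)) * ((x 1 - x 5) ^ 2 + (x 3 - x 7) ^ 2) := by
  simp [scaledHessian, Matrix.mulVec, dotProduct, Fin.sum_univ_succ]
  ring

variable {a c f : ℝ}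

theorem dotProduct_mulVec_nonneg (hc : c ≠ 0) (h : 2 * a * (a - f) < c ^ 2) (x : Fin 8 → ℝ) :
    0 ≤ x ⬝ᵥ (scaledHessian a c f).mulVec x := by
  have hs : 0 < 4 * (c ^ 2 + f ^ 2) := by positivity
  have hD : 0 < c ^ 2 - 2 * a * (a - f) := sub_pos.2 h
  refine nonneg_of_mul_nonneg_right ?_ hs
  rw [four_mul_dotProduct_mulVec]
  positivity

theorem eq_const_of_dotProduct_mulVec_eq_zero (hc : c ≠ 0) (hf : f ≠ 0)
    (h : 2 * a * (a - f) < c ^ 2) {x : Fin 8 → ℝ}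
    (hx : x ⬝ᵥ (scaledHessian a c f).mulVec x = 0) : x = fun _ => x 0 := by
  have hs : 0 < c ^ 2 + f ^ 2 := by positivity
  have hD : 0 < c ^ 2 - 2 * a * (a - f) := sub_pos.2 h
  have key := four_mul_dotProduct_mulVec a c f x
  rw [hx, mul_zero, eq_comm] at key
  rw [add_eq_zero_iff_of_nonneg (by positivity) (by positivity),
    add_eq_zero_iff_of_nonneg (by positivity) (by positivity),
    add_eq_zero_iff_of_nonneg (by positivity) (by positivity),
    add_eq_zero_iff_of_nonneg (by positivity) (by positivity),
    add_eq_zero_iff_of_nonneg (by positivity) (by positivity)] at key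
  simp only [mul_eq_zero, pow_eq_zero_iff, ne_eq, OfNat.ofNat_ne_zero, not_false_eq_true, hs.ne',
    hD.ne', hf, hc, false_or, add_eq_zero_iff_of_nonneg (sq_nonneg (x 1 - x 5))
      (sq_nonneg (x 3 - x 7))] at key
  obtain ⟨⟨⟨⟨⟨h₀, h₁⟩, h₂⟩, h₃⟩, h₄⟩, h₁₅, h₃₇⟩ := key
  simp only [h₁₅, h₃₇, mul_zero, sub_zero, add_zero, mul_eq_zero, hs.ne', false_or] at h₃ h₄
  funext i
  fin_cases i <;> simp <;> linarith

theorem isHermitian (a c f : ℝ) : (scaledHessian a c f).IsHermitian := by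
  ext i j
  fin_cases i <;> fin_cases j <;> simp [scaledHessian]

theorem posSemidef (hc : c ≠ 0) (h : 2 * a * (a - f) < c ^ 2) :
    (scaledHessian a c f).PosSemidef :=
  .of_dotProduct_mulVec_nonneg (isHermitian a c f) fun x => by
    simpa using dotProduct_mulVec_nonneg hc h x

theorem mulVec_const (a c f t : ℝ) : (scaledHessian a c f).mulVec (fun _ => t) = 0 := by
  funext i
  fin_cases i <;> simp [scaledHessian, Matrix.mulVec, dotProduct, Fin.sum_univ_succ] <;> ring

theorem mulVec_eq_zero_iff (hc : c ≠ 0) (hf : f ≠ 0) (h : 2 * a * (a - f) < c ^ 2)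
    (x : Fin 8 → ℝ) : (scaledHessian a c f).mulVec x = 0 ↔ ∃ t : ℝ, x = fun _ => t := by
  refine ⟨fun hx => ⟨x 0, eq_const_of_dotProduct_mulVec_eq_zero hc hf h (by simp [hx])⟩, ?_⟩
  rintro ⟨t, rfl⟩
  exact mulVec_const a c f t

end scaledHessian

/-- If `c² > 2ad` (with `a, c, d > 0`, `a > d`, `f = a − d`), the scaled Hessian
`M` of `G_{(a,b,c,d)}` at the equilibrium `θ*` is positive semidefinite, its kernel
is exactly the span of the all-ones vector, and every eigenvalue with an
eigenvector that is not constant is positive. -/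
theorem Gp_hessian_posSemidef (a c d f : ℝ)
    (ha : 0 < a) (hc : 0 < c) (hd : 0 < d) (had : d < a)
    (hf : f = a - d) (hstab : 2 * a * d < c ^ 2)
    (M : Matrix (Fin 8) (Fin 8) ℝ)
    (hM : M = !![c^2+f^2, -(a*f), 0, 0, 0, a*f-f^2, 0, -c^2;
                 -(a*f), c^2+f^2, -c^2, 0, a*f-f^2, 0, 0, 0;
                 0, -c^2, c^2+f^2, -(a*f), 0, 0, 0, a*f-f^2;
                 0, 0, -(a*f), c^2+f^2, -c^2, 0, a*f-f^2, 0;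
                 0, a*f-f^2, 0, -c^2, c^2+f^2, -(a*f), 0, 0;
                 a*f-f^2, 0, 0, 0, -(a*f), c^2+f^2, -c^2, 0;
                 0, 0, 0, a*f-f^2, 0, -c^2, c^2+f^2, -(a*f);
                 -c^2, 0, a*f-f^2, 0, 0, 0, -(a*f), c^2+f^2]) :
    M.PosSemidef ∧
    (∀ x : Fin 8 → ℝ, M.mulVec x = 0 ↔ ∃ t : ℝ, x = fun _ => t) ∧
    (∀ (μ : ℝ) (x : Fin 8 → ℝ), x ≠ 0 → M.mulVec x = μ • x →
      (∀ t : ℝ, x ≠ fun _ => t) → 0 < μ) := by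
  change M = scaledHessian a c f at hM
  have hf₀ : f ≠ 0 := (hf ▸ sub_pos.2 had : 0 < f).ne'
  have h : 2 * a * (a - f) < c ^ 2 := by simpa [hf] using hstab
  subst hM
  refine ⟨scaledHessian.posSemidef hc.ne' h, scaledHessian.mulVec_eq_zero_iff hc.ne' hf₀ h, ?_⟩
  intro μ x hx hμ hconst
  have hxx : 0 < x ⬝ᵥ x := by simpa using Matrix.dotProduct_star_self_pos_iff.2 hx
  have hQ : 0 < x ⬝ᵥ (scaledHessian a c f).mulVec x :=
    (scaledHessian.dotProduct_mulVec_nonneg hc.ne' h x).lt_of_ne' fun h₀ =>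
      hconst _ (scaledHessian.eq_const_of_dotProduct_mulVec_eq_zero hc.ne' hf₀ h h₀)
  rw [hμ, dotProduct_smul, smul_eq_mul] at hQ
  exact pos_of_mul_pos_left hQ hxx.le
end
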